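/- A point S ∈ I is an isolated point of the topological space (I, τ) (i.e., the one-point set {S} is τ-open) if and only if there exists an element a ∈ S such that U_a = {S}. -/

import Mathlib

/-- A subset `S` of a partially ordered set is *upward directed* if any two of its
elements have an upper bound in `S`. -/
def IsUpDirected {K : Type*} [PartialOrder K] (S : Set K) : Prop :=
  ∀ a ∈ S, ∀ b ∈ S, ∃ c ∈ S, a ≤ c ∧ b ≤ c

/-- A *maximal upward directed subset*: upward directed and maximal with respect to
inclusion among upward directed subsets. -/
def IsMaxUpDirected {K : Type*} [PartialOrder K] (S : Set K) : Prop :=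
  IsUpDirected S ∧ ∀ T : Set K, IsUpDirected T → S ⊆ T → T = S

/-- The index set `I` of all maximal upward directed subsets of `K`. -/
def Idx (K : Type*) [PartialOrder K] := {S : Set K // IsMaxUpDirected S}

/-- `U a = { S ∈ I : a ∈ S }`. -/
def U {K : Type*} [PartialOrder K] (a : K) : Set (Idx K) := {S : Idx K | a ∈ S.1}

/-- The topology `τ` on `I` generated by the family `{U a : a ∈ K}`. -/
def tau (K : Type*) [PartialOrder K] : TopologicalSpace (Idx K) :=
  TopologicalSpace.generateFrom (Set.range (fun a : K => U a))

/-- The lower closure of an upward directed set is upward directed. -/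
theorem IsUpDirected.lowerClosure {K : Type*} [PartialOrder K] {S : Set K}
    (hS : IsUpDirected S) : IsUpDirected {x | ∃ y ∈ S, x ≤ y} := by
  rintro a ⟨a', ha', haa'⟩ b ⟨b', hb', hbb'⟩
  obtain ⟨c, hc, hac, hbc⟩ := hS a' ha' b' hb'
  exact ⟨c, ⟨c, hc, le_rfl⟩, haa'.trans hac, hbb'.trans hbc⟩

theorem IsMaxUpDirected.isLowerSet {K : Type*} [PartialOrder K] {S : Set K}
    (hS : IsMaxUpDirected S) : IsLowerSet S := by
  intro a b hba ha
  rw [← hS.2 _ hS.1.lowerClosure fun x hx => ⟨x, hx, le_rfl⟩]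
  exact ⟨a, ha, hba⟩

theorem IsMaxUpDirected.nonempty {K : Type*} [PartialOrder K] [Nonempty K] {S : Set K}
    (hS : IsMaxUpDirected S) : S.Nonempty := by
  by_contra! h
  subst h
  obtain ⟨x⟩ := ‹Nonempty K›
  refine Set.singleton_ne_empty x (hS.2 {x} ?_ (Set.empty_subset _))
  rintro a rfl b rfl
  exact ⟨_, rfl, le_rfl, le_rfl⟩

theorem U_antitone {K : Type*} [PartialOrder K] : Antitone (U : K → Set (Idx K)) :=
  fun _ _ hab T hT => T.2.isLowerSet hab hT

/-- The sets `U a` with `a ∈ S` form a neighbourhood base at `S`. -/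
theorem exists_U_subset_of_isOpen {K : Type*} [PartialOrder K] [Nonempty K]
    {V : Set (Idx K)} (hV : (tau K).IsOpen V) {S : Idx K} (hS : S ∈ V) :
    ∃ a ∈ S.1, U a ⊆ V := by
  change TopologicalSpace.GenerateOpen _ V at hV
  induction hV with
  | basic V h =>
    obtain ⟨a, rfl⟩ := h
    exact ⟨a, hS, subset_rfl⟩
  | univ =>
    obtain ⟨a, ha⟩ := S.2.nonempty
    exact ⟨a, ha, Set.subset_univ _⟩
  | inter V W _ _ ihV ihW =>
    obtain ⟨a, ha, haV⟩ := ihV hS.1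
    obtain ⟨b, hb, hbW⟩ := ihW hS.2
    obtain ⟨c, hc, hac, hbc⟩ := S.2.1 a ha b hb
    exact ⟨c, hc, Set.subset_inter ((U_antitone hac).trans haV) ((U_antitone hbc).trans hbW)⟩
  | sUnion 𝒱 _ ih =>
    obtain ⟨V, hV, hSV⟩ := hS
    obtain ⟨a, ha, haV⟩ := ih V hV hSV
    exact ⟨a, ha, haV.trans (Set.subset_sUnion_of_mem hV)⟩

/-- A point `S ∈ I` is isolated in `(I, τ)` (i.e. `{S}` is `τ`-open) iff there is
`a ∈ S` with `U a = {S}`. -/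
theorem isolated_iff_exists_U_singleton (K : Type*) [PartialOrder K] [Nonempty K]
    (S : Idx K) :
    (tau K).IsOpen ({S} : Set (Idx K)) ↔ ∃ a ∈ S.1, U a = {S} := by
  constructor
  · intro h
    obtain ⟨a, ha, haS⟩ := exists_U_subset_of_isOpen h (Set.mem_singleton S)
    exact ⟨a, ha, haS.antisymm (Set.singleton_subset_iff.2 ha)⟩
  · rintro ⟨a, -, ha⟩
    rw [← ha]
    exact TopologicalSpace.GenerateOpen.basic _ ⟨a, rfl⟩
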